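/- (Non-equivalence, Remark 3.6(2).) Let f be a Markov interval map and x, y ∈ E_f such that for some k ∈ {1,…,n} one has â_{k,ι(x)} = 1 and â_{k,ι(y)} = 0. Then there is no unitary U : H_x → H_y with U S_{ij}^{(x)} U* = S_{ij}^{(y)} for all pairs (i,j) with a_{ij} = 1 and U P_i^{(x)} U* = P_i^{(y)} for all i. -/

import Mathlib

open scoped Classical ENNReal

noncomputable section

/-- Partition and branch data for a Markov interval map with `n` Markov
subintervals.  `cm j` is the point `c_j⁻` and `cp j` is `c_j⁺` (with
`cm 0 = cp 0 = c₀` and `cm n = cp n = c_n`).  `f` is the globally defined map,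
`F j` is the branch of `f` on the `j`-th Markov interval (indexed by
`j = 0, …, n-1`, corresponding to the interval `I_{j+1}` of the paper) and
`F' j` is the derivative of that branch. -/
structure MarkovSystem (n : ℕ) where
  cm : ℕ → ℝ
  cp : ℕ → ℝ
  f : ℝ → ℝ
  F : ℕ → ℝ → ℝ
  F' : ℕ → ℝ → ℝ
  two_le : 2 ≤ n
  cm_zero : cm 0 = cp 0
  cm_n : cm n = cp n
  cm_le_cp : ∀ j ≤ n, cm j ≤ cp j
  cp_lt_cm : ∀ j < n, cp j < cm (j + 1)

namespace MarkovSystem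

variable {n : ℕ} (M : MarkovSystem n)

/-- The Markov interval `I_{j+1} = [c_j⁺, c_{j+1}⁻]` (for `j < n`). -/
def Ipart (j : ℕ) : Set ℝ := Set.Icc (M.cp j) (M.cm (j + 1))

/-- The escape interval `E_j = (c_j⁻, c_j⁺)` (for `1 ≤ j ≤ n-1`). -/
def Epart (j : ℕ) : Set ℝ := Set.Ioo (M.cm j) (M.cp j)

/-- The ambient interval `I = [c₀, c_n]`. -/
def itv : Set ℝ := Set.Icc (M.cm 0) (M.cm n)

/-- The domain of `f`, namely `⋃_{j=1}^n I_j`. -/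
def dom : Set ℝ := ⋃ j ∈ Finset.range n, M.Ipart j

/-- The set `Γ` of partition boundary points. -/
def Gamma : Set ℝ := {y | ∃ j ≤ n, y = M.cm j ∨ y = M.cp j}

/-- `q`-fold image of a set under `f`, applying `f` only where it is defined. -/
def iterImage : ℕ → Set ℝ → Set ℝ
  | 0, S => S
  | q + 1, S => M.f '' (iterImage q S ∩ M.dom)

/-- `f^k(x)` is defined, i.e. all earlier iterates lie in the domain. -/
def definedUpTo (k : ℕ) (x : ℝ) : Prop := ∀ l < k, M.f^[l] x ∈ M.dom

/-- The orbit equivalence relation `R_f`. -/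
def Rrel (x y : ℝ) : Prop :=
  ∃ p q : ℕ, M.definedUpTo p x ∧ M.definedUpTo q y ∧ M.f^[p] x = M.f^[q] y

/-- The generalized orbit `R_f(x)` of a point `x ∈ I`. -/
def Rclass (x : ℝ) : Set ℝ := {y | y ∈ M.itv ∧ M.Rrel x y}

/-- The maximal invariant set `Ω_f`. -/
def Omega : Set ℝ := {x | x ∈ M.itv ∧ ∀ k, M.f^[k] x ∈ M.dom}

/-- The escape set `E_f = I \ Ω_f`. -/
def Esc : Set ℝ := M.itv \ M.Omega

/-- The regular set `Λ_f = Ω_f \ R_f(Γ)`. -/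
def Lambda : Set ℝ := {x | x ∈ M.Omega ∧ ∀ γ ∈ M.Gamma, ¬ M.Rrel x γ}

/-- The escape time of a point of the escape set. -/
def tau (x : ℝ) : ℕ := sInf {k | M.f^[k] x ∉ M.dom}

/-- The final escape point `e(x) = f^{τ(x)}(x)`. -/
def e (x : ℝ) : ℝ := M.f^[M.tau x] x

/-- The transition-matrix condition `a_{ij} = 1`, i.e. `f(int I_i) ⊇ int I_j`. -/
def trans (i j : ℕ) : Prop := interior (M.Ipart j) ⊆ M.F i '' interior (M.Ipart i)

/-- The escape-transition condition `â_{ik} = 1`, i.e. `int I_i ∩ f⁻¹(E_k) ≠ ∅`. -/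
def ahat (i k : ℕ) : Prop := (interior (M.Ipart i) ∩ M.F i ⁻¹' M.Epart k).Nonempty

end MarkovSystem

/-- The defining properties (P1)-(P4) of a Markov interval map, together with the
compatibility of the global map `f` with the branches `F j`:  `f` agrees with `F j`
on `I_j` except possibly at a boundary point shared with an adjacent interval,
where `f` is given by one of the two adjacent branches. -/
structure IsMarkov {n : ℕ} (M : MarkovSystem n) : Prop where
  compat₁ : ∀ j < n, ∀ x ∈ M.Ipart j, (∀ k < n, k ≠ j → x ∉ M.Ipart k) → M.f x = M.F j x
  compat₂ : ∀ x ∈ M.dom, ∃ j, j < n ∧ x ∈ M.Ipart j ∧ M.f x = M.F j x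
  maps_into : ∀ j < n, M.F j '' M.Ipart j ⊆ M.itv
  onto : M.itv ⊆ ⋃ j ∈ Finset.range n, M.F j '' M.Ipart j
  markov : ∀ i < n, ∃ S T : Set ℕ, S ⊆ {j | j < n} ∧ T ⊆ {j | 1 ≤ j ∧ j < n} ∧
    M.F i '' M.Ipart i = (⋃ j ∈ S, M.Ipart j) ∪ (⋃ j ∈ T, M.Epart j)
  deriv : ∀ i < n, ∀ x ∈ M.Ipart i, HasDerivWithinAt (M.F i) (M.F' i x) (M.Ipart i) x
  derivCont : ∀ i < n, ContinuousOn (M.F' i) (M.Ipart i)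
  mono : ∀ i < n, StrictMonoOn (M.F i) (M.Ipart i) ∨ StrictAntiOn (M.F i) (M.Ipart i)
  expansive : ∃ b > 1, ∀ i < n, ∀ x ∈ M.Ipart i, b < |M.F' i x|
  aperiodic : ∀ i < n, ∃ q, M.dom ⊆ M.iterImage q (M.Ipart i)

namespace MarkovSystem

variable {n : ℕ} (M : MarkovSystem n)

/-- The Hilbert space `H_x = ℓ²(R_f(x))`. -/
abbrev Hsp (x : ℝ) : Type _ := lp (fun _ : M.Rclass x => ℂ) 2

/-- The canonical orthonormal basis vector `δ_z` of `H_x`, for `z ∈ R_f(x)`. -/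
def dvec {x : ℝ} (z : M.Rclass x) : M.Hsp x := lp.single 2 z 1

/-- `T` is the bounded operator `T_i` on `H_x`, determined on the basis by
`T_i δ_y = δ_{(f|_{I_i})⁻¹(y)}` if `y ∈ f(I_i)` and `T_i δ_y = 0` otherwise. -/
def IsBranchOp (x : ℝ) (i : ℕ) (T : M.Hsp x →L[ℂ] M.Hsp x) : Prop :=
  (∀ z w : M.Rclass x, (w : ℝ) ∈ M.Ipart i → M.F i w = (z : ℝ) →
      T (M.dvec z) = M.dvec w) ∧
  (∀ z : M.Rclass x, (z : ℝ) ∉ M.F i '' M.Ipart i → T (M.dvec z) = 0)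

/-- `Pe` is the rank-one orthogonal projection onto `ℂ δ_{e(x)}`. -/
def IsEscProj (x : ℝ) (Pe : M.Hsp x →L[ℂ] M.Hsp x) : Prop :=
  ∀ z : M.Rclass x, Pe (M.dvec z) = if (z : ℝ) = M.e x then M.dvec z else 0

end MarkovSystem

namespace MarkovSystem

section helpers

variable {n : ℕ} {M : MarkovSystem n}

lemma aux_cp_lt_cm {i j : ℕ} (hij : i < j) (hj : j ≤ n) : M.cp i < M.cm j := by
  induction j with
  | zero => omega
  | succ j ih =>
    rcases Nat.lt_succ_iff_lt_or_eq.mp hij with h | h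
    · exact lt_of_lt_of_le (ih h (by omega)) (le_trans (M.cm_le_cp j (by omega))
        (M.cp_lt_cm j (by omega)).le)
    · subst h
      exact M.cp_lt_cm i (by omega)

lemma aux_cp_le {i j : ℕ} (hij : i ≤ j) (hj : j ≤ n) : M.cp i ≤ M.cp j := by
  rcases hij.eq_or_lt with h | h
  · rw [h]
  · exact (aux_cp_lt_cm h hj).le.trans (M.cm_le_cp j hj)

lemma aux_cm_le {i j : ℕ} (hij : i ≤ j) (hj : j ≤ n) : M.cm i ≤ M.cm j := by
  rcases hij.eq_or_lt with h | h
  · rw [h]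
  · exact (M.cm_le_cp i (by omega)).trans (aux_cp_lt_cm h hj).le

lemma aux_mem_dom {j : ℕ} (hj : j < n) {u : ℝ} (hu : u ∈ M.Ipart j) : u ∈ M.dom := by
  simp only [dom, Set.mem_iUnion]
  exact ⟨j, Finset.mem_range.mpr hj, hu⟩

lemma aux_dom {u : ℝ} (hu : u ∈ M.dom) : ∃ j < n, u ∈ M.Ipart j := by
  simp only [dom, Set.mem_iUnion] at hu
  obtain ⟨j, hj, h⟩ := hu
  exact ⟨j, Finset.mem_range.mp hj, h⟩

lemma aux_I_itv {j : ℕ} (hj : j < n) {u : ℝ} (hu : u ∈ M.Ipart j) : u ∈ M.itv := by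
  refine ⟨?_, hu.2.trans (aux_cm_le hj le_rfl)⟩
  rw [M.cm_zero]
  exact (aux_cp_le (Nat.zero_le j) hj.le).trans hu.1

lemma aux_E_I {i j : ℕ} (hi : i < n) (hj : j < n) {u : ℝ} (hE : u ∈ M.Epart j) :
    u ∉ M.Ipart i := by
  intro hI
  rcases lt_or_ge i j with h | h
  · have := aux_cm_le (M := M) (show i + 1 ≤ j from h) hj.le
    have h1 := hI.2
    have h2 := hE.1
    linarith
  · have := aux_cp_le (M := M) h hi.le
    have h1 := hI.1
    have h2 := hE.2
    linarith

lemma aux_E_E {i j : ℕ} (hi : i < n) (hj : j < n) {u : ℝ} (hE : u ∈ M.Epart j)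
    (hI : u ∈ M.Epart i) : i = j := by
  rcases lt_trichotomy i j with h | h | h
  · have := aux_cp_lt_cm (M := M) h hj.le
    have h1 := hI.2
    have h2 := hE.1
    linarith
  · exact h
  · have := aux_cp_lt_cm (M := M) h hi.le
    have h1 := hI.1
    have h2 := hE.2
    linarith

lemma aux_Ioo_I {i j : ℕ} (hi : i < n) (hj : j < n) {u : ℝ}
    (hu : u ∈ Set.Ioo (M.cp j) (M.cm (j + 1))) (hI : u ∈ M.Ipart i) : i = j := by
  rcases lt_trichotomy i j with h | h | h
  · have h3 := aux_cm_le (M := M) (show i + 1 ≤ j from h) hj.le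
    have h4 := M.cm_le_cp j hj.le
    have h1 := hI.2
    have h2 := hu.1
    linarith
  · exact h
  · have h3 := aux_cm_le (M := M) (show j + 1 ≤ i from h) hi.le
    have h4 := M.cm_le_cp i hi.le
    have h1 := hI.1
    have h2 := hu.2
    linarith

lemma aux_Ioo_Gamma {j : ℕ} (hj : j < n) {u : ℝ}
    (hu : u ∈ Set.Ioo (M.cp j) (M.cm (j + 1))) : u ∉ M.Gamma := by
  rintro ⟨i, hi, h⟩
  have h1 := hu.1
  have h2 := hu.2
  rcases Nat.lt_or_ge j i with hji | hji
  · have h3 := aux_cm_le (M := M) (show j + 1 ≤ i from hji) hi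
    have h4 := M.cm_le_cp i hi
    rcases h with h | h <;> linarith
  · have h3 := aux_cp_le (M := M) hji hj.le
    have h4 := M.cm_le_cp i hi
    rcases h with h | h <;> linarith

lemma aux_E_Gamma {j : ℕ} (hj : j < n) {u : ℝ} (hu : u ∈ M.Epart j) : u ∉ M.Gamma := by
  rintro ⟨i, hi, h⟩
  have h1 := hu.1
  have h2 := hu.2
  have h4 := M.cm_le_cp i hi
  rcases lt_trichotomy i j with hji | hji | hji
  · have h3 := aux_cp_lt_cm (M := M) hji hj.le
    rcases h with h | h <;> linarith
  · subst hji
    rcases h with h | h <;> linarith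
  · have h3 := aux_cp_lt_cm (M := M) hji hi
    rcases h with h | h <;> linarith

lemma aux_Ioo_of_not_Gamma {j : ℕ} (hj : j < n) {u : ℝ} (hu : u ∈ M.Ipart j)
    (hG : u ∉ M.Gamma) : u ∈ Set.Ioo (M.cp j) (M.cm (j + 1)) := by
  refine ⟨lt_of_le_of_ne hu.1 ?_, lt_of_le_of_ne hu.2 ?_⟩
  · intro h
    exact hG ⟨j, hj.le, Or.inr h.symm⟩
  · intro h
    exact hG ⟨j + 1, hj, Or.inl h⟩

lemma aux_Gamma_dom {u : ℝ} (hu : u ∈ M.Gamma) : u ∈ M.dom := by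
  obtain ⟨i, hi, h⟩ := hu
  have key1 : M.cm i ∈ M.dom := by
    rcases i with _ | i
    · have h0 : 0 < n := by have := M.two_le; omega
      exact aux_mem_dom h0 ⟨M.cm_zero.ge, by rw [M.cm_zero]; exact (M.cp_lt_cm 0 h0).le⟩
    · exact aux_mem_dom (j := i) (by omega) ⟨(M.cp_lt_cm i (by omega)).le, le_rfl⟩
  have key2 : M.cp i ∈ M.dom := by
    rcases hi.eq_or_lt with h1 | h1
    · have h2 : M.cm i = M.cp i := by rw [h1]; exact M.cm_n
      rw [← h2]; exact key1
    · exact aux_mem_dom (j := i) h1 ⟨le_rfl, (M.cp_lt_cm i h1).le⟩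
  rcases h with h | h <;> rw [h] <;> assumption

lemma aux_extreme (hM : IsMarkov M) {i : ℕ} (hi : i < n) {m : ℝ}
    (hm : m ∈ M.F i '' M.Ipart i)
    (hext : (∀ p ∈ M.F i '' M.Ipart i, m ≤ p) ∨ (∀ p ∈ M.F i '' M.Ipart i, p ≤ m)) :
    m ∈ M.Gamma := by
  obtain ⟨S, T, hS, hT, hA⟩ := hM.markov i hi
  rw [hA] at hm hext
  rcases hm with hm | hm
  · simp only [Set.mem_iUnion] at hm
    obtain ⟨j, hj, hmj⟩ := hm
    have hjn : j < n := hS hj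
    by_contra hG
    have hI := aux_Ioo_of_not_Gamma hjn hmj hG
    have hlt := (M.cp_lt_cm j hjn).le
    rcases hext with h | h
    · have := h (M.cp j) (Or.inl (Set.mem_biUnion hj ⟨le_rfl, hlt⟩))
      linarith [hI.1]
    · have := h (M.cm (j + 1)) (Or.inl (Set.mem_biUnion hj ⟨hlt, le_rfl⟩))
      linarith [hI.2]
  · exfalso
    simp only [Set.mem_iUnion] at hm
    obtain ⟨j, hj, h1, h2⟩ := hm
    rcases hext with h | h
    · have := h ((M.cm j + m) / 2) (Or.inr (Set.mem_biUnion hj ⟨by linarith, by linarith⟩))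
      linarith
    · have := h ((M.cp j + m) / 2) (Or.inr (Set.mem_biUnion hj ⟨by linarith, by linarith⟩))
      linarith

lemma aux_F_Gamma (hM : IsMarkov M) {i : ℕ} (hi : i < n) {u : ℝ} (hu : u ∈ M.Ipart i)
    (hG : u ∈ M.Gamma) : M.F i u ∈ M.Gamma := by
  have hend : u = M.cp i ∨ u = M.cm (i + 1) := by
    by_contra hcon
    push Not at hcon
    exact aux_Ioo_Gamma hi ⟨lt_of_le_of_ne hu.1 hcon.1.symm, lt_of_le_of_ne hu.2 hcon.2⟩ hG
  apply aux_extreme hM hi ⟨u, hu, rfl⟩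
  rcases hM.mono i hi with hmon | hmon
  · rcases hend with h | h
    · left
      rintro _ ⟨v, hv, rfl⟩
      exact (hmon.le_iff_le hu hv).mpr (by rw [h]; exact hv.1)
    · right
      rintro _ ⟨v, hv, rfl⟩
      exact (hmon.le_iff_le hv hu).mpr (by rw [h]; exact hv.2)
  · rcases hend with h | h
    · right
      rintro _ ⟨v, hv, rfl⟩
      exact (hmon.le_iff_ge hv hu).mpr (by rw [h]; exact hv.1)
    · left
      rintro _ ⟨v, hv, rfl⟩
      exact (hmon.le_iff_ge hu hv).mpr (by rw [h]; exact hv.2)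

lemma aux_f_Gamma (hM : IsMarkov M) {u : ℝ} (hG : u ∈ M.Gamma) : M.f u ∈ M.Gamma := by
  obtain ⟨j, hj, hu, hf⟩ := hM.compat₂ u (aux_Gamma_dom hG)
  rw [hf]
  exact aux_F_Gamma hM hj hu hG

lemma aux_f_eq (hM : IsMarkov M) {i : ℕ} (hi : i < n) {u : ℝ} (hu : u ∈ M.Ipart i)
    (hG : u ∉ M.Gamma) : M.f u = M.F i u :=
  hM.compat₁ i hi u hu fun _ hk hne h =>
    hne (aux_Ioo_I hk hi (aux_Ioo_of_not_Gamma hi hu hG) h)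

lemma aux_class_Gamma (hM : IsMarkov M) {x : ℝ} (hx : x ∈ M.Esc) {v : ℝ}
    (hv : v ∈ M.Rclass x) : v ∉ M.Gamma := by
  intro hG
  obtain ⟨-, p, q, hp, -, hpq⟩ := hv
  have hit : ∀ m (w : ℝ), w ∈ M.Gamma → M.f^[m] w ∈ M.Gamma := by
    intro m
    induction m with
    | zero => intro w hw; exact hw
    | succ m ih => intro w hw; exact ih _ (aux_f_Gamma hM hw)
  apply hx.2
  refine ⟨hx.1, fun l => ?_⟩
  rcases lt_or_ge l p with h | h
  · exact hp l h
  · obtain ⟨m, rfl⟩ := Nat.exists_eq_add_of_le' h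
    rw [Function.iterate_add_apply, hpq]
    exact aux_Gamma_dom (hit _ _ (hit _ _ hG))

lemma aux_class_e {x : ℝ} {v : ℝ} (hv : v ∈ M.Rclass x) (hd : v ∉ M.dom) : v = M.e x := by
  obtain ⟨-, p, q, hp, hq, hpq⟩ := hv
  have hq0 : q = 0 := by
    by_contra h
    exact hd (hq 0 (Nat.pos_of_ne_zero h))
  subst hq0
  have hpq' : M.f^[p] x = v := hpq
  have htau : M.tau x = p := by
    apply le_antisymm
    · exact Nat.sInf_le (by simpa [hpq'] using hd)
    · refine le_csInf ⟨p, by simpa [hpq'] using hd⟩ fun l hl => ?_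
      by_contra hlt
      exact hl (hp l (by omega))
  rw [e, htau, hpq']

lemma aux_e_class {x : ℝ} {j : ℕ} (hj : j < n) (hE : M.e x ∈ M.Epart j) :
    M.e x ∈ M.Rclass x := by
  refine ⟨⟨(aux_cm_le (Nat.zero_le j) hj.le).trans hE.1.le, ?_⟩, M.tau x, 0, ?_, ?_, rfl⟩
  · exact hE.2.le.trans (aux_cp_lt_cm hj le_rfl).le
  · intro l hl
    by_contra h
    exact Nat.notMem_of_lt_sInf hl h
  · intro l hl
    omega

lemma aux_pre_not_Gamma (hM : IsMarkov M) {i : ℕ} (hi : i < n) {w : ℝ} (hw : w ∈ M.Ipart i)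
    (hF : M.F i w ∉ M.Gamma) : w ∉ M.Gamma :=
  fun h => hF (aux_F_Gamma hM hi hw h)

lemma aux_pre_class (hM : IsMarkov M) {x : ℝ} (hx : x ∈ M.Esc) {i : ℕ} (hi : i < n) {w : ℝ}
    (hw : w ∈ M.Ipart i) (hF : M.F i w ∈ M.Rclass x) : w ∈ M.Rclass x := by
  have hG := aux_pre_not_Gamma hM hi hw (aux_class_Gamma hM hx hF)
  obtain ⟨-, p, q, hp, hq, hpq⟩ := hF
  refine ⟨aux_I_itv hi hw, p, q + 1, hp, ?_, ?_⟩
  · intro l hl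
    rcases l with _ | l
    · exact aux_mem_dom hi hw
    · rw [Function.iterate_succ_apply, aux_f_eq hM hi hw hG]
      exact hq l (by omega)
  · rw [Function.iterate_succ_apply, aux_f_eq hM hi hw hG, hpq]

lemma aux_img_class (hM : IsMarkov M) {x : ℝ} (hx : x ∈ M.Esc) {i : ℕ} (hi : i < n) {w : ℝ}
    (hw : w ∈ M.Ipart i) (hc : w ∈ M.Rclass x) : M.F i w ∈ M.Rclass x := by
  have hG := aux_class_Gamma hM hx hc
  have hf := aux_f_eq hM hi hw hG
  obtain ⟨-, p, q, hp, hq, hpq⟩ := hc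
  refine ⟨hM.maps_into i hi ⟨w, hw, rfl⟩, ?_⟩
  rcases q with _ | q
  · refine ⟨p + 1, 0, ?_, fun l hl => by omega, ?_⟩
    · intro l hl
      rcases Nat.lt_succ_iff_lt_or_eq.mp hl with h | h
      · exact hp l h
      · rw [h, hpq]
        exact aux_mem_dom hi hw
    · rw [Function.iterate_succ_apply', hpq]
      simpa using hf
  · refine ⟨p, q, hp, ?_, ?_⟩
    · intro l hl
      have := hq (l + 1) (by omega)
      rwa [Function.iterate_succ_apply, hf] at this
    · rw [hpq, Function.iterate_succ_apply, hf]

lemma aux_E_sub (hM : IsMarkov M) {k j : ℕ} (hk : k < n) (hj : j < n) (ha : M.ahat k j)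
    {u : ℝ} (hu : u ∈ M.Epart j) : ∃ w ∈ M.Ipart k, M.F k w = u := by
  obtain ⟨v, hv, hvE⟩ := ha
  obtain ⟨S, T, hS, hT, hA⟩ := hM.markov k hk
  have hmem : M.F k v ∈ M.F k '' M.Ipart k := ⟨v, interior_subset hv, rfl⟩
  rw [hA] at hmem
  have hjT : j ∈ T := by
    rcases hmem with h | h
    · simp only [Set.mem_iUnion] at h
      obtain ⟨i, hi, h⟩ := h
      exact absurd h (aux_E_I (hS hi) hj hvE)
    · simp only [Set.mem_iUnion] at h
      obtain ⟨i, hi, h⟩ := h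
      rwa [← aux_E_E (hT hi).2 hj hvE h]
  have : u ∈ M.F k '' M.Ipart k := by
    rw [hA]
    exact Or.inr (Set.mem_biUnion hjT hu)
  exact this

lemma aux_interior {j : ℕ} : interior (M.Ipart j) = Set.Ioo (M.cp j) (M.cm (j + 1)) :=
  interior_Icc

lemma aux_ahat (hM : IsMarkov M) {k j : ℕ} (hk : k < n) (hj : j < n) {w : ℝ}
    (hw : w ∈ M.Ipart k) (hE : M.F k w ∈ M.Epart j) : M.ahat k j := by
  refine ⟨w, ?_, hE⟩
  rw [aux_interior]
  exact aux_Ioo_of_not_Gamma hk hw (aux_pre_not_Gamma hM hk hw (aux_E_Gamma hj hE))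

lemma aux_trans (hM : IsMarkov M) {k j : ℕ} (hk : k < n) (hj : j < n) {z : ℝ}
    (hz : z ∈ M.Ipart k) (hI : M.F k z ∈ M.Ipart j) (hG : M.F k z ∉ M.Gamma) :
    M.trans k j := by
  have hoo := aux_Ioo_of_not_Gamma hj hI hG
  obtain ⟨S, T, hS, hT, hA⟩ := hM.markov k hk
  have hmem : M.F k z ∈ M.F k '' M.Ipart k := ⟨z, hz, rfl⟩
  rw [hA] at hmem
  have hjS : j ∈ S := by
    rcases hmem with h | h
    · simp only [Set.mem_iUnion] at h
      obtain ⟨i, hi, h⟩ := h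
      rwa [← aux_Ioo_I (hS hi) hj hoo h]
    · simp only [Set.mem_iUnion] at h
      obtain ⟨i, hi, h⟩ := h
      exact absurd hI (aux_E_I hj (hT hi).2 h)
  intro p hp
  rw [aux_interior] at hp
  have hpm : p ∈ M.F k '' M.Ipart k := by
    rw [hA]
    exact Or.inl (Set.mem_biUnion hjS ⟨hp.1.le, hp.2.le⟩)
  obtain ⟨v, hv, rfl⟩ := hpm
  refine ⟨v, ?_, rfl⟩
  rw [aux_interior]
  exact aux_Ioo_of_not_Gamma hk hv (aux_pre_not_Gamma hM hk hv (aux_Ioo_Gamma hj hp))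

lemma aux_inner_dvec {x : ℝ} (z : M.Rclass x) (ξ : M.Hsp x) :
    inner ℂ (M.dvec z) ξ = ξ z := by
  rw [dvec, lp.inner_single_left]
  simp

lemma aux_dvec_apply {x : ℝ} (z w : M.Rclass x) :
    (M.dvec z) w = if w = z then (1 : ℂ) else 0 := by
  rw [dvec, lp.single_apply]
  by_cases h : w = z
  · subst h
    simp
  · simp [h]

lemma aux_star_apply {x : ℝ} (T : M.Hsp x →L[ℂ] M.Hsp x) (z v : M.Rclass x) :
    (star T (M.dvec z)) v = inner ℂ (T (M.dvec v)) (M.dvec z) := by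
  rw [← aux_inner_dvec, ContinuousLinearMap.star_eq_adjoint,
    ContinuousLinearMap.adjoint_inner_right]

/-- `T_i^* δ_z = 0` when `z ∉ I_i`. -/
lemma aux_star_zero (hM : IsMarkov M) {x : ℝ} (hx : x ∈ M.Esc) {i : ℕ} (hi : i < n)
    {T : M.Hsp x →L[ℂ] M.Hsp x} (hT : M.IsBranchOp x i T) (z : M.Rclass x)
    (hz : (z : ℝ) ∉ M.Ipart i) : star T (M.dvec z) = 0 := by
  ext v
  rw [aux_star_apply]
  by_cases hv : (v : ℝ) ∈ M.F i '' M.Ipart i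
  · obtain ⟨w, hw, hF⟩ := hv
    have hwc : w ∈ M.Rclass x := aux_pre_class hM hx hi hw (by rw [hF]; exact v.2)
    rw [hT.1 v ⟨w, hwc⟩ hw hF, aux_inner_dvec, aux_dvec_apply, if_neg]
    · rfl
    · rintro rfl
      exact hz hw
  · rw [hT.2 v hv]
    simp

/-- `T_i^* δ_z = δ_{F_i z}` when `z ∈ I_i`. -/
lemma aux_star_mem (hM : IsMarkov M) {x : ℝ} (hx : x ∈ M.Esc) {i : ℕ} (hi : i < n)
    {T : M.Hsp x →L[ℂ] M.Hsp x} (hT : M.IsBranchOp x i T) (z u : M.Rclass x)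
    (hz : (z : ℝ) ∈ M.Ipart i) (hu : M.F i z = u) : star T (M.dvec z) = M.dvec u := by
  ext v
  rw [aux_star_apply, aux_dvec_apply]
  by_cases hv : (v : ℝ) ∈ M.F i '' M.Ipart i
  · obtain ⟨w, hw, hF⟩ := hv
    have hwc : w ∈ M.Rclass x := aux_pre_class hM hx hi hw (by rw [hF]; exact v.2)
    rw [hT.1 v ⟨w, hwc⟩ hw hF, aux_inner_dvec, aux_dvec_apply]
    have hinj : Set.InjOn (M.F i) (M.Ipart i) := by
      rcases hM.mono i hi with h | h
      · exact h.injOn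
      · exact h.injOn
    congr 1
    apply propext
    constructor
    · rintro rfl
      exact Subtype.ext (hF.symm.trans hu)
    · rintro rfl
      exact Subtype.ext (hinj hw hz (hF.trans hu.symm))
  · rw [hT.2 v hv, if_neg]
    · simp
    · rintro rfl
      exact hv ⟨z, hz, hu⟩

end helpers

end MarkovSystem

open MarkovSystem

/-- Remark 3.6(2) (non-equivalence): if for some `k` one has `â_{k,ι(x)} = 1`
and `â_{k,ι(y)} = 0`, then no unitary `U : H_x → H_y` conjugates each
`S_{ij}^{(x)}` to `S_{ij}^{(y)}` and each `P_i^{(x)}` to `P_i^{(y)}`. -/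
theorem not_unitarily_equivalent {n : ℕ} (M : MarkovSystem n) (hM : IsMarkov M)
    {x y : ℝ} (hx : x ∈ M.Esc) (hy : y ∈ M.Esc)
    {jx jy : ℕ} (hjx : 1 ≤ jx ∧ jx < n) (hjy : 1 ≤ jy ∧ jy < n)
    (hex : M.e x ∈ M.Epart jx) (hey : M.e y ∈ M.Epart jy)
    {k : ℕ} (hk : k < n) (hax : M.ahat k jx) (hay : ¬ M.ahat k jy)
    (Tx : ℕ → (M.Hsp x →L[ℂ] M.Hsp x)) (hTx : ∀ i < n, M.IsBranchOp x i (Tx i))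
    (Ty : ℕ → (M.Hsp y →L[ℂ] M.Hsp y)) (hTy : ∀ i < n, M.IsBranchOp y i (Ty i)) :
    ¬ ∃ U : M.Hsp x ≃ₗᵢ[ℂ] M.Hsp y,
      (∀ i < n, ∀ j < n, M.trans i j → ∀ ξ : M.Hsp x,
        U ((Tx i * (Tx j * star (Tx j))) ξ) = (Ty i * (Ty j * star (Ty j))) (U ξ)) ∧
      (∀ i < n, ∀ ξ : M.Hsp x,
        U ((Tx i * star (Tx i)) ξ) = (Ty i * star (Ty i)) (U ξ)) := by
  rintro ⟨U, hS, hP⟩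
  -- the point `w ∈ I_k` with `F_k w = e(x)`
  obtain ⟨w, hw, hFw⟩ := aux_E_sub hM hk hjx.2 hax hex
  have hec := aux_e_class hjx.2 hex
  have hwc : w ∈ M.Rclass x := aux_pre_class hM hx hk hw (by rw [hFw]; exact hec)
  have hstar : star (Tx k) (M.dvec ⟨w, hwc⟩) = M.dvec ⟨M.e x, hec⟩ :=
    aux_star_mem hM hx hk (hTx k hk) ⟨w, hwc⟩ ⟨M.e x, hec⟩ hw hFw
  have hPw : (Tx k * star (Tx k)) (M.dvec ⟨w, hwc⟩) = M.dvec ⟨w, hwc⟩ := by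
    rw [ContinuousLinearMap.mul_apply, hstar]
    exact (hTx k hk).1 _ _ hw hFw
  -- `δ_w` is orthogonal to the range of each `S_{kj}`
  have horth : ∀ j < n, ∀ ξ : M.Hsp x,
      inner ℂ ((Tx k * (Tx j * star (Tx j))) ξ) (M.dvec ⟨w, hwc⟩) = 0 := by
    intro j hj ξ
    rw [ContinuousLinearMap.mul_apply, ← ContinuousLinearMap.adjoint_inner_right,
      ← ContinuousLinearMap.star_eq_adjoint, hstar, ContinuousLinearMap.mul_apply,
      ← ContinuousLinearMap.adjoint_inner_right, ← ContinuousLinearMap.star_eq_adjoint,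
      aux_star_zero hM hx hj (hTx j hj) ⟨M.e x, hec⟩ (aux_E_I hj hjx.2 hex), inner_zero_right]
  have hzero : U (M.dvec ⟨w, hwc⟩) = 0 := by
    ext z
    rw [← aux_inner_dvec]
    by_cases hz : (z : ℝ) ∈ M.Ipart k
    · have huc := aux_img_class hM hy hk hz z.2
      have hud : M.F k z ∈ M.dom := by
        by_contra hd
        have hue := aux_class_e huc hd
        exact hay (aux_ahat hM hk hjy.2 hz (by rw [hue]; exact hey))
      obtain ⟨j, hj, huj⟩ := aux_dom hud
      have htr := aux_trans hM hk hj hz huj (aux_class_Gamma hM hy huc)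
      have hSz : (Ty k * (Ty j * star (Ty j))) (M.dvec ⟨M.F k z, huc⟩) = M.dvec z := by
        rw [ContinuousLinearMap.mul_apply, ContinuousLinearMap.mul_apply,
          aux_star_mem hM hy hj (hTy j hj) ⟨M.F k z, huc⟩ ⟨_, aux_img_class hM hy hj huj huc⟩
            huj rfl,
          (hTy j hj).1 ⟨_, aux_img_class hM hy hj huj huc⟩ ⟨M.F k z, huc⟩ huj rfl]
        exact (hTy k hk).1 _ _ hz rfl
      have h := hS k hk j hj htr (U.symm (M.dvec ⟨M.F k z, huc⟩))
      rw [U.apply_symm_apply, hSz] at h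
      rw [← h, U.inner_map_map]
      exact horth j hj _
    · rw [← hPw, hP k hk, ContinuousLinearMap.mul_apply,
        ← ContinuousLinearMap.adjoint_inner_left, ← ContinuousLinearMap.star_eq_adjoint,
        aux_star_zero hM hy hk (hTy k hk) z hz, inner_zero_left]
      rfl
  have hw0 : M.dvec (⟨w, hwc⟩ : M.Rclass x) = 0 := by
    simpa using hzero
  have h1 := aux_dvec_apply (M := M) (⟨w, hwc⟩ : M.Rclass x) ⟨w, hwc⟩
  rw [hw0, if_pos rfl] at h1
  simp at h1
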